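/- Let A be an algebra with Day operations m₀,…,m_n, let k ≥ 2, T = (θ₀,…,θ_{k-1}) ∈ Con(A)^k, j < k, and δ ∈ Con(A). Then C(T; j; δ) holds if and only if [T]_j ≤ δ. -/

import Mathlib

namespace UACommutator

/-- A signature: a type of operation symbols with arities. -/
structure Signature where
  ops : Type
  arity : ops → ℕ

/-- An algebra for a signature: a nonempty carrier with interpretations of the operations. -/
structure Alg (σ : Signature) where
  carrier : Type
  nonempty : Nonempty carrier
  interp : (o : σ.ops) → (Fin (σ.arity o) → carrier) → carrier

/-- A congruence of an algebra: an equivalence relation compatible with all basic operations. -/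
structure Congruence {σ : Signature} (A : Alg σ) where
  rel : A.carrier → A.carrier → Prop
  iseqv : Equivalence rel
  compat : ∀ (o : σ.ops) (x y : Fin (σ.arity o) → A.carrier),
    (∀ i, rel (x i) (y i)) → rel (A.interp o x) (A.interp o y)

instance {σ : Signature} {A : Alg σ} : LE (Congruence A) :=
  ⟨fun a b => ∀ x y, a.rel x y → b.rel x y⟩

/-- Terms of the signature with variables in `V`. -/
inductive Term (σ : Signature) (V : Type) : Type
  | var : V → Term σ V
  | app : (o : σ.ops) → (Fin (σ.arity o) → Term σ V) → Term σ V

def Term.evalA {σ : Signature} (A : Alg σ) {V : Type} :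
    Term σ V → (V → A.carrier) → A.carrier
  | .var v, env => env v
  | .app o args, env => A.interp o (fun i => (args i).evalA A env)

/-- Polynomial operations of an algebra `A` with variables in `V`:
built from variables, constants of `A`, and the basic operations. -/
inductive Poly {σ : Signature} (A : Alg σ) (V : Type) : Type
  | var : V → Poly A V
  | const : A.carrier → Poly A V
  | app : (o : σ.ops) → (Fin (σ.arity o) → Poly A V) → Poly A V

def Poly.eval {σ : Signature} {A : Alg σ} {V : Type} :
    Poly A V → (V → A.carrier) → A.carrier
  | .var v, env => env v
  | .const c, _ => c
  | .app o args, env => A.interp o (fun i => (args i).eval env)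

/-- Evaluate a polynomial whose variables are grouped into `k` tuples (tuple `i` of
length `ν i`) at the tuples `a i` (where `g i = false`) or `b i` (where `g i = true`). -/
def evalTup {σ : Signature} {A : Alg σ} {k : ℕ} {ν : Fin k → ℕ}
    (p : Poly A (Σ i, Fin (ν i))) (a b : ∀ i, Fin (ν i) → A.carrier)
    (g : Fin k → Bool) : A.carrier :=
  p.eval (fun x => if g x.1 then b x.1 x.2 else a x.1 x.2)

/-- The term condition `C(α₀,…,α_{k-1}; δ)`, centralizing at coordinate `j`. -/
def TC {σ : Signature} {A : Alg σ} {k : ℕ} (α : Fin k → Congruence A) (j : Fin k)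
    (δ : Congruence A) : Prop :=
  ∀ (ν : Fin k → ℕ) (p : Poly A (Σ i, Fin (ν i)))
    (a b : ∀ i, Fin (ν i) → A.carrier),
    (∀ i mm, (α i).rel (a i mm) (b i mm)) →
    (∀ g : Fin k → Bool, g j = false → (∃ i, i ≠ j ∧ g i = false) →
      δ.rel (evalTup p a b g) (evalTup p a b (Function.update g j true))) →
    δ.rel (evalTup p a b (Function.update (fun _ => true) j false))
          (evalTup p a b (fun _ => true))

/-- The meet (intersection) of a family of congruences. -/
def infCong {σ : Signature} {A : Alg σ} {ι : Sort*} (ds : ι → Congruence A) :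
    Congruence A where
  rel x y := ∀ i, (ds i).rel x y
  iseqv := ⟨fun x i => (ds i).iseqv.refl x,
            fun h i => (ds i).iseqv.symm (h i),
            fun h h' i => (ds i).iseqv.trans (h i) (h' i)⟩
  compat o x y h := fun i => (ds i).compat o x y (fun mm => h mm i)

/-- The higher commutator `[α₀,…,α_{k-1}]` (term-condition version), as the meet of
all congruences `δ` such that `C(α₀,…,α_{k-1}; δ)` holds, centralizing at `j`. -/
def commTC {σ : Signature} {A : Alg σ} {k : ℕ} (α : Fin k → Congruence A) (j : Fin k) :
    Congruence A :=
  infCong (fun d : {δ : Congruence A // TC α j δ} => d.val)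

/-- The congruence generated by a binary relation `X`. -/
def Cg {σ : Signature} {A : Alg σ} (X : A.carrier → A.carrier → Prop) : Congruence A :=
  infCong (fun d : {δ : Congruence A // ∀ x y, X x y → δ.rel x y} => d.val)

theorem Cg_base {σ : Signature} {A : Alg σ} (X : A.carrier → A.carrier → Prop)
    {x y : A.carrier} (h : X x y) : (Cg X).rel x y :=
  fun i => i.2 x y h

/-- The join of a family of congruences: the least congruence containing every member. -/
def supCong {σ : Signature} {A : Alg σ} {ι : Sort*} (γ : ι → Congruence A) :
    Congruence A :=
  Cg (fun x y => ∃ i, (γ i).rel x y)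

/-- The join of two congruences. -/
def joinCong {σ : Signature} {A : Alg σ} (a b : Congruence A) : Congruence A :=
  Cg (fun x y => a.rel x y ∨ b.rel x y)

/-- `m` is a `T`-matrix for `T = (θ₀,…,θ_{k-1})`. -/
def IsMatrix {σ : Signature} {A : Alg σ} {k : ℕ} (θ : Fin k → Congruence A)
    (m : (Fin k → Bool) → A.carrier) : Prop :=
  ∃ (ν : Fin k → ℕ) (p : Poly A (Σ i, Fin (ν i))) (a b : ∀ i, Fin (ν i) → A.carrier),
    (∀ i jj, (θ i).rel (a i jj) (b i jj)) ∧
    ∀ f : Fin k → Bool, m f = evalTup p a b f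

/-- The matrix centralization condition `C(T; j; δ)`: for every `T`-matrix, if every
`(j)`-supporting line is a `δ`-pair then the `(j)`-pivot line is a `δ`-pair. -/
def CMat {σ : Signature} {A : Alg σ} {k : ℕ} (θ : Fin k → Congruence A) (j : Fin k)
    (δ : Congruence A) : Prop :=
  ∀ m : (Fin k → Bool) → A.carrier, IsMatrix θ m →
    (∀ g : Fin k → Bool, (∃ i, i ≠ j ∧ g i = false) →
      δ.rel (m (Function.update g j false)) (m (Function.update g j true))) →
    δ.rel (m (Function.update (fun _ => true) j false)) (m (fun _ => true))

/-- `[T]_j`: the meet of all congruences `δ` with `C(T; j; δ)`. -/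
def commMat {σ : Signature} {A : Alg σ} {k : ℕ} (θ : Fin k → Congruence A) (j : Fin k) :
    Congruence A :=
  infCong (fun d : {δ : Congruence A // CMat θ j δ} => d.val)

/-- Day operations `m₀, …, m_n` for an algebra, each induced by a term of the signature. -/
structure DayOps {σ : Signature} (A : Alg σ) (n : ℕ) where
  m : Fin (n+1) → A.carrier → A.carrier → A.carrier → A.carrier → A.carrier
  isTerm : ∀ e, ∃ t : Term σ (Fin 4), ∀ x y z u, m e x y z u = t.evalA A ![x, y, z, u]
  idem : ∀ e x y, m e x y y x = x
  first : ∀ x y z u, m 0 x y z u = x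
  last : ∀ x y z u, m (Fin.last n) x y z u = u
  even : ∀ (e : ℕ) (he : e < n), Even e → ∀ x u,
    m ⟨e, by omega⟩ x x u u = m ⟨e+1, by omega⟩ x x u u
  odd : ∀ (e : ℕ) (he : e < n), Odd e → ∀ x y u,
    m ⟨e, by omega⟩ x y y u = m ⟨e+1, by omega⟩ x y y u

/-- The `e`-th shift rotation at `(j, l)` of a cube `h`. -/
def shiftRot {σ : Signature} {A : Alg σ} {n k : ℕ} (D : DayOps A n) (e : Fin (n+1))
    (j l : Fin k) (h : (Fin k → Bool) → A.carrier) :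
    (Fin k → Bool) → A.carrier := fun f =>
  let r := h (Function.update (Function.update f j false) l false)
  let s := h (Function.update (Function.update f j false) l true)
  let u := h (Function.update (Function.update f j true) l false)
  let v := h (Function.update (Function.update f j true) l true)
  if f j then (if f l then D.m e s s v v else D.m e s r u v) else s

/-- `hIter D m hm d h` is `h^{(d₀,…,d_{m-1})}`: the result of applying the shift
rotations `R^{d₀}_{0,1}, …, R^{d_{m-1}}_{m-1,m}` successively to `h`. -/
def hIter {σ : Signature} {A : Alg σ} {n k : ℕ} (D : DayOps A n) :
    (m : ℕ) → m < k → (Fin m → Fin (n+1)) → ((Fin k → Bool) → A.carrier) →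
    ((Fin k → Bool) → A.carrier)
  | 0, _, _, h => h
  | (m+1), hm, d, h =>
      shiftRot D (d (Fin.last m)) ⟨m, by omega⟩ ⟨m+1, hm⟩
        (hIter D m (by omega) (fun i => d i.castSucc) h)

/-- `X(T)`: the set of `(k-1)`-pivot lines of the matrices `h^d`, over all `T`-matrices
`h` and all `d ∈ {0,…,n}^{k-1}`. -/
def XSet {σ : Signature} {A : Alg σ} {n k : ℕ} (hk : 0 < k) (D : DayOps A n)
    (θ : Fin k → Congruence A) : A.carrier → A.carrier → Prop :=
  fun x y => ∃ h : (Fin k → Bool) → A.carrier, IsMatrix θ h ∧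
    ∃ d : Fin (k-1) → Fin (n+1),
      x = hIter D (k-1) (by omega) d h
            (Function.update (fun _ => true) (⟨k-1, by omega⟩ : Fin k) false) ∧
      y = hIter D (k-1) (by omega) d h (fun _ => true)

/-- Product algebra `A^I` with pointwise operations. -/
def prodAlg {σ : Signature} (A : Alg σ) (I : Type) : Alg σ where
  carrier := I → A.carrier
  nonempty := ⟨fun _ => Classical.choice A.nonempty⟩
  interp o x := fun i => A.interp o (fun mm => x mm i)

/-- Membership in the subalgebra of `B` generated by a set `S`. -/
inductive Gen {σ : Signature} (B : Alg σ) (S : Set B.carrier) : B.carrier → Prop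
  | base : ∀ x ∈ S, Gen B S x
  | app : ∀ (o : σ.ops) (x : Fin (σ.arity o) → B.carrier),
      (∀ i, Gen B S (x i)) → Gen B S (B.interp o x)

/-- `f : A → B` is a homomorphism. -/
def IsHom {σ : Signature} (A B : Alg σ) (f : A.carrier → B.carrier) : Prop :=
  ∀ (o : σ.ops) (x : Fin (σ.arity o) → A.carrier),
    f (A.interp o x) = B.interp o (fun i => f (x i))

/-- The kernel congruence of a homomorphism. -/
def kerCong {σ : Signature} {A B : Alg σ} (f : A.carrier → B.carrier)
    (hf : IsHom A B f) : Congruence A where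
  rel x y := f x = f y
  iseqv := ⟨fun _ => rfl, Eq.symm, Eq.trans⟩
  compat o x y h := by
    show f (A.interp o x) = f (A.interp o y)
    rw [hf o x, hf o y]
    congr 1
    funext i
    exact h i

/-- The image `f(γ)` of a congruence `γ ≥ ker f` under a surjective homomorphism `f`. -/
def mapCong {σ : Signature} {A B : Alg σ} (f : A.carrier → B.carrier)
    (hf : IsHom A B f) (hs : Function.Surjective f) (γ : Congruence A)
    (hγ : ∀ x y, f x = f y → γ.rel x y) : Congruence B where
  rel u v := ∃ x y, γ.rel x y ∧ f x = u ∧ f y = v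
  iseqv := by
    refine ⟨?_, ?_, ?_⟩
    · intro u
      obtain ⟨x, hx⟩ := hs u
      exact ⟨x, x, γ.iseqv.refl x, hx, hx⟩
    · rintro u v ⟨x, y, hxy, hx, hy⟩
      exact ⟨y, x, γ.iseqv.symm hxy, hy, hx⟩
    · rintro u v w ⟨x, y, hxy, hx, hy⟩ ⟨y', z, hyz, hy', hz⟩
      exact ⟨x, z, γ.iseqv.trans hxy (γ.iseqv.trans (hγ y y' (hy.trans hy'.symm)) hyz),
        hx, hz⟩
  compat o u v h := by
    choose x y hxy hx hy using h
    refine ⟨A.interp o x, A.interp o y, γ.compat o x y hxy, ?_, ?_⟩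
    · rw [hf o x]
      congr 1
      funext i
      exact hx i
    · rw [hf o y]
      congr 1
      funext i
      exact hy i

/-- The preimage `f⁻¹(β)` of a congruence of `B` under a homomorphism `f`. -/
def comapCong {σ : Signature} {A B : Alg σ} (f : A.carrier → B.carrier)
    (hf : IsHom A B f) (β : Congruence B) : Congruence A where
  rel x y := β.rel (f x) (f y)
  iseqv := ⟨fun _ => β.iseqv.refl _, β.iseqv.symm, β.iseqv.trans⟩
  compat o x y h := by
    show β.rel (f (A.interp o x)) (f (A.interp o y))
    rw [hf o x, hf o y]
    exact β.compat o _ _ h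

/-- Substitution of polynomials for the variables of a polynomial. -/
def Poly.subst {σ : Signature} {A : Alg σ} {V W : Type} :
    Poly A V → (V → Poly A W) → Poly A W
  | .var v, q => q v
  | .const c, _ => .const c
  | .app o args, q => .app o (fun i => (args i).subst q)

theorem Poly.eval_subst {σ : Signature} {A : Alg σ} {V W : Type} (p : Poly A V)
    (q : V → Poly A W) (env : W → A.carrier) :
    (p.subst q).eval env = p.eval (fun v => (q v).eval env) := by
  induction p with
  | var v => rfl
  | const c => rfl
  | app o args ih => simp only [Poly.subst, Poly.eval, ih]

/-- Substitution of polynomials for the variables of a term. -/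
def Term.substPoly {σ : Signature} (A : Alg σ) {V W : Type} :
    Term σ V → (V → Poly A W) → Poly A W
  | .var v, q => q v
  | .app o args, q => .app o (fun i => (args i).substPoly A q)

theorem Term.eval_substPoly {σ : Signature} {A : Alg σ} {V W : Type} (t : Term σ V)
    (q : V → Poly A W) (env : W → A.carrier) :
    (t.substPoly A q).eval env = t.evalA A (fun v => (q v).eval env) := by
  induction t with
  | var v => rfl
  | app o args ih => simp only [Term.substPoly, Poly.eval, Term.evalA, ih]

theorem Congruence.rel_evalA {σ : Signature} {A : Alg σ} (δ : Congruence A) {V : Type}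
    (t : Term σ V) {x y : V → A.carrier} (h : ∀ v, δ.rel (x v) (y v)) :
    δ.rel (t.evalA A x) (t.evalA A y) := by
  induction t with
  | var v => exact h v
  | app o args ih => exact δ.compat o _ _ ih

theorem DayOps.rel_m {σ : Signature} {A : Alg σ} {n : ℕ} (D : DayOps A n)
    (δ : Congruence A) (e : Fin (n + 1)) {x y z u x' y' z' u' : A.carrier}
    (hx : δ.rel x x') (hy : δ.rel y y') (hz : δ.rel z z') (hu : δ.rel u u') :
    δ.rel (D.m e x y z u) (D.m e x' y' z' u') := by
  obtain ⟨t, ht⟩ := D.isTerm e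
  rw [ht, ht]
  refine δ.rel_evalA t fun v => ?_
  fin_cases v <;> assumption

/-- The Day operations detect membership in a congruence: if `(r, u) ∈ δ`, then
`(s, v) ∈ δ` as soon as every `m_e(s,r,u,v)` is `δ`-related to `m_e(s,s,v,v)`. -/
theorem DayOps.rel_of_forall_rel {σ : Signature} {A : Alg σ} {n : ℕ} (D : DayOps A n)
    (δ : Congruence A) {r s u v : A.carrier} (hru : δ.rel r u)
    (h : ∀ e, δ.rel (D.m e s r u v) (D.m e s s v v)) : δ.rel s v := by
  have key : ∀ (e : ℕ) (he : e < n + 1), δ.rel s (D.m ⟨e, he⟩ s s v v) := by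
    intro e
    induction e with
    | zero =>
      intro he
      have h0 : D.m ⟨0, he⟩ s s v v = s := D.first s s v v
      rw [h0]
      exact δ.iseqv.refl s
    | succ e ih =>
      intro he
      have ih := ih (by omega)
      rcases Nat.even_or_odd e with hev | hodd
      · rwa [← D.even e (by omega) hev]
      · have h₁ := D.rel_m δ ⟨e, by omega⟩ (δ.iseqv.refl s) (δ.iseqv.refl r) hru
          (δ.iseqv.refl v)
        have h₂ := D.rel_m δ ⟨e + 1, he⟩ (δ.iseqv.refl s) (δ.iseqv.refl r) hru
          (δ.iseqv.refl v)
        rw [D.odd e (by omega) hodd] at h₁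
        exact δ.iseqv.trans ih (δ.iseqv.trans (δ.iseqv.symm (h _))
          (δ.iseqv.trans (δ.iseqv.symm h₁) (δ.iseqv.trans h₂ (h _))))
  have hn := key n (by omega)
  have hlast : D.m ⟨n, by omega⟩ s s v v = v := D.last s s v v
  rwa [hlast] at hn

/-- A shift rotation is the pointwise application of a Day operation to faces of the cube. -/
theorem shiftRot_apply {σ : Signature} {A : Alg σ} {n k : ℕ} (D : DayOps A n)
    (e : Fin (n + 1)) {i l : Fin k} (hil : i ≠ l) (h : (Fin k → Bool) → A.carrier)
    (f : Fin k → Bool) :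
    shiftRot D e i l h f =
      D.m e (h (Function.update (Function.update f i false) l true))
        (h (Function.update f i false)) (h f) (h (Function.update f l true)) := by
  have hi : Function.update f i (f i) = f := Function.update_eq_self i f
  have hl : Function.update f l (f l) = f := Function.update_eq_self l f
  have hl' : Function.update (Function.update f i false) l (f l) =
      Function.update f i false := by
    rw [Function.update_comm hil, hl]
  unfold shiftRot
  cases hfi : f i <;> cases hfl : f l <;> rw [hfi] at hi <;> rw [hfl] at hl hl' <;>
    simp [hi, hl, hl', D.idem]

/-- Passing to faces `f ↦ f[i ↦ ε]` is realized by substituting constants. -/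
theorem exists_evalTup_update {σ : Signature} {A : Alg σ} {k : ℕ} {ν : Fin k → ℕ}
    (p : Poly A (Σ i, Fin (ν i))) (a b : ∀ i, Fin (ν i) → A.carrier) (i : Fin k)
    (ε : Bool) :
    ∃ q : Poly A (Σ i, Fin (ν i)),
      ∀ f, evalTup q a b f = evalTup p a b (Function.update f i ε) := by
  refine ⟨p.subst fun x => if x.1 = i then
    .const (if ε then b x.1 x.2 else a x.1 x.2) else .var x, fun f => ?_⟩
  unfold evalTup
  rw [Poly.eval_subst]
  congr 1
  funext x
  by_cases hx : x.1 = i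
  · simp only [hx, if_true, Poly.eval, Function.update_self]
  · simp only [hx, if_false, Poly.eval, Function.update_of_ne hx]

theorem IsMatrix.shiftRot {σ : Signature} {A : Alg σ} {n k : ℕ} (D : DayOps A n)
    (e : Fin (n + 1)) {θ : Fin k → Congruence A} {i l : Fin k} (hil : i ≠ l)
    {h : (Fin k → Bool) → A.carrier} (hh : IsMatrix θ h) :
    IsMatrix θ (shiftRot D e i l h) := by
  obtain ⟨ν, p, a, b, hab, hp⟩ := hh
  obtain ⟨t, ht⟩ := D.isTerm e
  obtain ⟨q, hq⟩ := exists_evalTup_update p a b l true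
  obtain ⟨q', hq'⟩ := exists_evalTup_update p a b i false
  obtain ⟨q'', hq''⟩ := exists_evalTup_update q a b i false
  refine ⟨ν, t.substPoly A ![q'', q', p, q], a, b, hab, fun f => ?_⟩
  rw [shiftRot_apply D e hil, ht, hp, hp, hp, hp, ← hq, ← hq'', ← hq', ← hq]
  unfold evalTup
  rw [Term.eval_substPoly]
  congr 1
  funext v
  fin_cases v <;> rfl

/-- Every `(i)`-line of `h` lying on a face `f l = false`, `l ∈ S ∖ {i}`, is a `δ`-pair. -/
def LinesIn {σ : Signature} {A : Alg σ} {k : ℕ} (δ : Congruence A) (S : Finset (Fin k))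
    (i : Fin k) (h : (Fin k → Bool) → A.carrier) : Prop :=
  ∀ g : Fin k → Bool, (∃ l ∈ S, l ≠ i ∧ g l = false) →
    δ.rel (h (Function.update g i false)) (h (Function.update g i true))

theorem LinesIn.shiftRot {σ : Signature} {A : Alg σ} {n k : ℕ} (D : DayOps A n)
    (e : Fin (n + 1)) {δ : Congruence A} {S : Finset (Fin k)} {i l : Fin k} (hil : i ≠ l)
    {h : (Fin k → Bool) → A.carrier} (hh : LinesIn δ S i h) :
    LinesIn δ (insert i S) l (shiftRot D e i l h) := by
  rintro g ⟨c, hcS, hcl, hgc⟩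
  -- every value on the line is `δ`-related to the corner `s`
  suffices key : ∀ ε, δ.rel (UACommutator.shiftRot D e i l h (Function.update g l ε))
      (h (Function.update (Function.update g i false) l true)) from
    δ.iseqv.trans (key false) (δ.iseqv.symm (key true))
  intro ε
  have hface : ∀ η, δ.rel (h (Function.update g l η))
      (h (Function.update (Function.update g l η) i false)) := by
    intro η
    by_cases hgi : g i = false
    · have hself : Function.update (Function.update g l η) i false = Function.update g l η :=
        Function.update_eq_self_iff.2 (by rw [Function.update_of_ne hil, hgi])
      rw [hself]
      exact δ.iseqv.refl _
    · have hci : c ≠ i := fun hci => hgi (hci ▸ hgc)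
      have hself : Function.update (Function.update g l η) i true = Function.update g l η :=
        Function.update_eq_self_iff.2
          (by rw [Function.update_of_ne hil, Bool.eq_true_of_not_eq_false hgi])
      have hc := hh (Function.update g l η)
        ⟨c, (Finset.mem_insert.1 hcS).resolve_left hci, hci, by
          rw [Function.update_of_ne hcl, hgc]⟩
      rw [hself] at hc
      exact δ.iseqv.symm hc
  have hm := D.rel_m δ e
    (δ.iseqv.refl (h (Function.update (Function.update g l true) i false)))
    (δ.iseqv.refl (h (Function.update (Function.update g l ε) i false)))
    (hface ε) (hface true)
  rw [D.idem] at hm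
  rw [shiftRot_apply D e hil]
  have hcomm : Function.update (Function.update g i false) l true =
      Function.update (Function.update g l true) i false := Function.update_comm hil _ _ _
  have hcomm' : Function.update (Function.update (Function.update g l ε) i false) l true =
      Function.update (Function.update g l true) i false := by
    rw [Function.update_comm hil.symm, Function.update_idem, hcomm]
  rw [hcomm, hcomm', Function.update_idem]
  exact hm

/-- The pivot line in direction `i` is a `δ`-pair. -/
def PivotIn {σ : Signature} {A : Alg σ} {k : ℕ} (δ : Congruence A) (i : Fin k)
    (h : (Fin k → Bool) → A.carrier) : Prop :=
  δ.rel (h (Function.update (fun _ => true) i false)) (h (fun _ => true))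

theorem PivotIn.of_shiftRot {σ : Signature} {A : Alg σ} {n k : ℕ} (D : DayOps A n)
    {δ : Congruence A} {i l : Fin k} (hil : i ≠ l) {h : (Fin k → Bool) → A.carrier}
    (hh : LinesIn δ Finset.univ i h)
    (hpiv : ∀ e, PivotIn δ l (shiftRot D e i l h)) : PivotIn δ i h := by
  have hru := hh (Function.update (fun _ => true) l false)
    ⟨l, Finset.mem_univ l, hil.symm, Function.update_self ..⟩
  have hu : Function.update (Function.update (fun _ : Fin k => true) l false) i true =
      Function.update (fun _ => true) l false :=
    Function.update_eq_self_iff.2 (by rw [Function.update_of_ne hil])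
  rw [hu] at hru
  refine D.rel_of_forall_rel δ hru fun e => ?_
  have hl : Function.update (fun _ : Fin k => true) l true = fun _ => true :=
    Function.update_eq_self_iff.2 rfl
  have he := hpiv e
  unfold PivotIn at he
  rw [shiftRot_apply D e hil, shiftRot_apply D e hil] at he
  have hil' : Function.update (Function.update (fun _ : Fin k => true) i false) l true =
      Function.update (fun _ => true) i false :=
    Function.update_eq_self_iff.2 (by rw [Function.update_of_ne hil.symm])
  rwa [Function.update_comm hil.symm, Function.update_idem, Function.update_idem, hil', hl,
    Function.update_comm hil] at he

/-- Rotating through the coordinates in `U` and finally back to `j` reduces the pivot line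
of a matrix to pivot lines of matrices all of whose supporting lines are `δ'`-pairs. -/
theorem CMat.pivotIn_of_linesIn {σ : Signature} {A : Alg σ} {n k : ℕ} (D : DayOps A n)
    {θ : Fin k → Congruence A} {j : Fin k} {δ' δ : Congruence A} (hC : CMat θ j δ')
    (hle : δ' ≤ δ) (U : Finset (Fin k)) :
    ∀ (S : Finset (Fin k)) (i : Fin k) (h : (Fin k → Bool) → A.carrier), i ∉ U → j ∉ U →
      (∀ l, l ≠ j → l ≠ i → l ∉ U → l ∈ S) → IsMatrix θ h → LinesIn δ' S i h →
      LinesIn δ Finset.univ i h → PivotIn δ i h := by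
  have hlast : ∀ (S : Finset (Fin k)) (h : (Fin k → Bool) → A.carrier),
      (∀ l, l ≠ j → l ∈ S) → IsMatrix θ h → LinesIn δ' S j h → PivotIn δ j h :=
    fun S h hS hh hlin => hle _ _
      (hC h hh fun g ⟨c, hcj, hgc⟩ => hlin g ⟨c, hS c hcj, hcj, hgc⟩)
  have hrot : ∀ {i l : Fin k} {h : (Fin k → Bool) → A.carrier} (e : Fin (n + 1)), i ≠ l →
      LinesIn δ Finset.univ i h → LinesIn δ Finset.univ l (shiftRot D e i l h) :=
    fun {i l h} e hil hlin => by
      simpa only [Finset.insert_eq_of_mem (Finset.mem_univ i)] using hlin.shiftRot D e hil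
  induction U using Finset.induction_on with
  | empty =>
    intro S i h _ _ hS hh hlin' hlin
    by_cases hij : i = j
    · subst hij
      exact hlast S h (fun l hl => hS l hl hl (Finset.notMem_empty l)) hh hlin'
    · refine PivotIn.of_shiftRot D hij hlin fun e => hlast (insert i S) _ (fun l hl => ?_)
        (hh.shiftRot D e hij) (hlin'.shiftRot D e hij)
      by_cases hli : l = i
      · exact hli ▸ Finset.mem_insert_self l S
      · exact Finset.mem_insert_of_mem (hS l hl hli (Finset.notMem_empty l))
  | insert l U hlU ih =>
    intro S i h hiU hjU hS hh hlin' hlin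
    rw [Finset.mem_insert, not_or] at hiU hjU
    refine PivotIn.of_shiftRot D hiU.1 hlin fun e => ih (insert i S) l _ hlU hjU.2
      (fun c hcj hcl hcU => ?_) (hh.shiftRot D e hiU.1) (hlin'.shiftRot D e hiU.1)
      (hrot e hiU.1 hlin)
    by_cases hci : c = i
    · exact hci ▸ Finset.mem_insert_self c S
    · exact Finset.mem_insert_of_mem (hS c hcj hci (by simp [hcl, hcU]))

/-- In the presence of Day operations, centralization is inherited by larger congruences. -/
theorem CMat.mono {σ : Signature} {A : Alg σ} {n k : ℕ} (D : DayOps A n)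
    {θ : Fin k → Congruence A} {j : Fin k} {δ' δ : Congruence A} (hC : CMat θ j δ')
    (hle : δ' ≤ δ) : CMat θ j δ := by
  intro h hh hlin
  refine hC.pivotIn_of_linesIn D hle (Finset.univ.erase j) ∅ j h (Finset.notMem_erase j _)
    (Finset.notMem_erase j _) (fun l hlj _ hlU => ?_) hh (fun g ⟨c, hc, _⟩ => ?_)
    (fun g ⟨c, _, hc⟩ => hlin g ⟨c, hc⟩)
  · exact absurd (Finset.mem_erase.2 ⟨hlj, Finset.mem_univ l⟩) hlU
  · exact absurd hc (Finset.notMem_empty c)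

theorem CMat_commMat {σ : Signature} {A : Alg σ} {k : ℕ} (θ : Fin k → Congruence A)
    (j : Fin k) : CMat θ j (commMat θ j) :=
  fun m hm hlin d => d.2 m hm fun g hg => hlin g hg d

theorem CMat_iff_commMat_le {σ : Signature} (A : Alg σ) (n : ℕ)
    (D : DayOps A n) (k : ℕ) (hk : 2 ≤ k) (θ : Fin k → Congruence A)
    (j : Fin k) (δ : Congruence A) :
    CMat θ j δ ↔ commMat θ j ≤ δ := by
  exact ⟨fun hC _ _ hxy => hxy ⟨δ, hC⟩, fun hle => (CMat_commMat θ j).mono D hle⟩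

end UACommutator
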